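/- BBL inequality for p = 1/s with arbitrary real s > 0: Let s > 0 be real, λ ∈ (0,1), let n > 0 be an integer, and let f, g, h : ℝⁿ → [0,∞) be integrable with ∫ f > 0 and ∫ g > 0. Assume that for every x₀ ∈ supp(f) and x₁ ∈ supp(g), h((1−λ)x₀ + λx₁) ≥ ((1−λ)f(x₀)^{1/s} + λ g(x₁)^{1/s})^s. Then (∫_{ℝⁿ} h dx)^{1/(n+s)} ≥ (1−λ)(∫_{ℝⁿ} f dx)^{1/(n+s)} + λ(∫_{ℝⁿ} g dx)^{1/(n+s)}. -/

import Mathlib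

open MeasureTheory

open scoped ENNReal Pointwise

/-- The weighted power mean of exponent `1 / s` (not normalised), on `[0, ∞]`. -/
noncomputable def ennrealPowMean (a b s : ℝ) (x y : ℝ≥0∞) : ℝ≥0∞ :=
  (ENNReal.ofReal a * x ^ (1 / s) + ENNReal.ofReal b * y ^ (1 / s)) ^ s

lemma ennrealPowMean_mono {a b s : ℝ} (hs : 0 < s) {x x' y y' : ℝ≥0∞} (hx : x ≤ x')
    (hy : y ≤ y') : ennrealPowMean a b s x y ≤ ennrealPowMean a b s x' y' := by
  unfold ennrealPowMean
  gcongr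

lemma continuous_ennrealPowMean (a b s : ℝ) :
    Continuous fun p : ℝ≥0∞ × ℝ≥0∞ => ennrealPowMean a b s p.1 p.2 := by
  unfold ennrealPowMean
  refine ENNReal.continuous_rpow_const.comp (Continuous.add ?_ ?_)
  · exact (ENNReal.continuous_const_mul ENNReal.ofReal_ne_top).comp
      (ENNReal.continuous_rpow_const.comp continuous_fst)
  · exact (ENNReal.continuous_const_mul ENNReal.ofReal_ne_top).comp
      (ENNReal.continuous_rpow_const.comp continuous_snd)

/-- One-dimensional Brunn–Minkowski inequality for compact sets. -/
lemma volume_add_le_of_isCompact {K L C : Set ℝ} (hK : IsCompact K) (hL : IsCompact L)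
    (hKne : K.Nonempty) (hLne : L.Nonempty) (hC : ∀ x ∈ K, ∀ y ∈ L, x + y ∈ C) :
    volume K + volume L ≤ volume C := by
  have hu := hK.sSup_mem hKne
  have hl := hL.sInf_mem hLne
  set u := sSup K
  set l := sInf L
  have h1 : volume ((fun x => x + -l) ⁻¹' K) = volume K := measure_preimage_add_right _ _ _
  have h2 : volume ((fun x => x + -u) ⁻¹' L) = volume L := measure_preimage_add_right _ _ _
  rw [← h1, ← h2, ← measure_union₀]
  · refine measure_mono ?_
    rintro z (hz | hz)
    · simpa using hC _ hz _ hl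
    · simpa using hC _ hu _ hz
  · exact (hL.measurableSet.preimage (measurable_add_const _)).nullMeasurableSet
  · refine measure_mono_null (t := {u + l}) ?_ (by simp)
    rintro z ⟨hz, hz'⟩
    have h3 : z + -l ≤ u := le_csSup hK.bddAbove hz
    have h4 : l ≤ z + -u := csInf_le hL.bddBelow hz'
    simp only [Set.mem_singleton_iff]
    linarith

/-- One-dimensional Brunn–Minkowski inequality. -/
lemma volume_add_le_of_measurableSet {A B C : Set ℝ} (hA : MeasurableSet A)
    (hB : MeasurableSet B) (hAne : A.Nonempty) (hBne : B.Nonempty)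
    (hC : ∀ x ∈ A, ∀ y ∈ B, x + y ∈ C) : volume A + volume B ≤ volume C := by
  obtain ⟨p, hp⟩ := hAne
  obtain ⟨q, hq⟩ := hBne
  have key : ∀ K, (K ⊆ A ∧ IsCompact K) → ∀ L, (L ⊆ B ∧ IsCompact L) →
      volume K + volume L ≤ volume C := by
    rintro K ⟨hKA, hK⟩ L ⟨hLB, hL⟩
    refine le_trans (add_le_add (measure_mono (Set.subset_insert p K))
      (measure_mono (Set.subset_insert q L))) ?_
    refine volume_add_le_of_isCompact (hK.insert p) (hL.insert q) (by simp) (by simp) ?_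
    intro x hx y hy
    exact hC _ (Set.insert_subset hp hKA hx) _ (Set.insert_subset hq hLB hy)
  rw [hA.measure_eq_iSup_isCompact, hB.measure_eq_iSup_isCompact]
  simp only [iSup_and']
  exact ENNReal.biSup_add_biSup_le' ⟨∅, by simp⟩ ⟨∅, by simp⟩ key

/-- One-dimensional Prékopa–Leindler type inequality for minima of functions of supremum `1`. -/
lemma lintegral_add_le_of_min_le {a b : ℝ} (ha : 0 < a) (hb : 0 < b) {φ ψ χ : ℝ → ℝ≥0∞}
    (hφ : Measurable φ) (hψ : Measurable ψ) (hχ : Measurable χ)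
    (hφ1 : ∀ x, φ x ≤ 1) (hψ1 : ∀ x, ψ x ≤ 1)
    (hφs : ∀ t < 1, ∃ x, t < φ x) (hψs : ∀ t < 1, ∃ x, t < ψ x)
    (hyp : ∀ x y, min (φ x) (ψ y) ≤ χ (a * x + b * y)) :
    ENNReal.ofReal a * (∫⁻ x, φ x) + ENNReal.ofReal b * (∫⁻ x, ψ x) ≤ ∫⁻ x, χ x := by
  wlog hχ1 : ∀ x, χ x ≤ 1 generalizing χ
  · refine (this (χ := fun x => min (χ x) 1) (hχ.min measurable_const) ?_ ?_).trans
      (lintegral_mono fun x => min_le_left _ _)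
    · exact fun x y => le_min (hyp x y) (min_le_of_left_le (hφ1 x))
    · exact fun x => min_le_right _ _
  have layer : ∀ η : ℝ → ℝ≥0∞, Measurable η → (∀ x, η x ≤ 1) →
      ∫⁻ x, η x = ∫⁻ t in Set.Ioi (0 : ℝ), volume {x | ENNReal.ofReal t < η x} := by
    intro η hη h1
    have hne : ∀ x, η x ≠ ∞ := fun x => ne_top_of_le_ne_top (by simp) (h1 x)
    have := lintegral_eq_lintegral_meas_lt (f := fun x => (η x).toReal) volume
      (Filter.Eventually.of_forall fun x => ENNReal.toReal_nonneg) hη.ennreal_toReal.aemeasurable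
    simp only [ENNReal.ofReal_toReal (hne _)] at this
    rw [this]
    refine setLIntegral_congr_fun measurableSet_Ioi fun t ht => ?_
    congr 1
    ext x
    exact (ENNReal.ofReal_lt_iff_lt_toReal (le_of_lt ht) (hne x)).symm
  rw [layer φ hφ hφ1, layer ψ hψ hψ1, layer χ hχ hχ1]
  refine (add_le_add (lintegral_const_mul_le _ _) (lintegral_const_mul_le _ _)).trans
    ((le_lintegral_add _ _).trans (lintegral_mono fun t => ?_))
  rcases lt_or_ge (ENNReal.ofReal t) 1 with ht | ht
  · have hmul : ∀ c : ℝ, 0 < c → ∀ S : Set ℝ,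
        ENNReal.ofReal c * volume S = volume (c • S) := by
      intro c hc S
      rw [Measure.addHaar_smul]
      simp [abs_of_pos hc]
    simp only
    rw [hmul a ha, hmul b hb]
    refine volume_add_le_of_measurableSet
      ((measurableSet_lt measurable_const hφ).const_smul₀ a)
      ((measurableSet_lt measurable_const hψ).const_smul₀ b)
      (Set.Nonempty.smul_set (hφs _ ht)) (Set.Nonempty.smul_set (hψs _ ht)) ?_
    rintro _ ⟨x, hx, rfl⟩ _ ⟨y, hy, rfl⟩
    exact (lt_min hx hy).trans_le (hyp x y)
  · have h1 : {x | ENNReal.ofReal t < φ x} = ∅ :=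
      Set.eq_empty_of_forall_notMem fun x hx => absurd hx (not_lt.2 ((hφ1 x).trans ht))
    have h2 : {x | ENNReal.ofReal t < ψ x} = ∅ :=
      Set.eq_empty_of_forall_notMem fun x hx => absurd hx (not_lt.2 ((hψ1 x).trans ht))
    simp [h1, h2]

/-- Hölder's inequality in the form used to combine the one-dimensional estimates. -/
lemma ennrealPowMean_le_mul {a b s : ℝ} (hs : 0 < s) {M N A B : ℝ≥0∞}
    (hM0 : M ≠ 0) (hM : M ≠ ∞) (hN0 : N ≠ 0) (hN : N ≠ ∞) :
    ennrealPowMean a b (1 + s) A B ≤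
      ennrealPowMean a b s M N * (ENNReal.ofReal a * (A / M) + ENNReal.ofReal b * (B / N)) := by
  have hs1 : 0 < 1 + s := by positivity
  have cancel : ∀ {M : ℝ≥0∞} (A : ℝ≥0∞), M ≠ 0 → M ≠ ∞ →
      M ^ (1 / s) * (A ^ (1 / (1 + s)) / M ^ (1 / s)) = A ^ (1 / (1 + s)) ∧
      M ^ (1 / s) * (A ^ (1 / (1 + s)) / M ^ (1 / s)) ^ (1 + s) = A / M := by
    intro M A h0 hT
    have h0' : M ^ (1 / s) ≠ 0 := by simp [h0, hT]
    have hT' : M ^ (1 / s) ≠ ∞ := ENNReal.rpow_ne_top_of_nonneg (by positivity) hT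
    refine ⟨ENNReal.mul_div_cancel h0' hT', ?_⟩
    rw [ENNReal.div_rpow_of_nonneg _ _ hs1.le, ← ENNReal.rpow_mul, ← ENNReal.rpow_mul,
      one_div_mul_cancel hs1.ne', ENNReal.rpow_one,
      show 1 / s * (1 + s) = 1 / s + 1 by field_simp, ENNReal.rpow_add _ _ h0 hT,
      ENNReal.rpow_one, div_eq_mul_inv A, div_eq_mul_inv A,
      ENNReal.mul_inv (Or.inl h0') (Or.inl hT'), mul_left_comm, ← mul_assoc (M ^ (1 / s)),
      ENNReal.mul_inv_cancel h0' hT', one_mul]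
  have := ENNReal.inner_le_weight_mul_Lp_of_nonneg Finset.univ (p := 1 + s) (by linarith)
    ![ENNReal.ofReal a * M ^ (1 / s), ENNReal.ofReal b * N ^ (1 / s)]
    ![A ^ (1 / (1 + s)) / M ^ (1 / s), B ^ (1 / (1 + s)) / N ^ (1 / s)]
  simp only [Fin.sum_univ_two, Matrix.cons_val_zero, Matrix.cons_val_one, mul_assoc,
    (cancel A hM0 hM).1, (cancel A hM0 hM).2, (cancel B hN0 hN).1, (cancel B hN0 hN).2] at this
  unfold ennrealPowMean
  refine (ENNReal.rpow_le_rpow this hs1.le).trans_eq ?_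
  rw [ENNReal.mul_rpow_of_nonneg _ _ hs1.le, ← ENNReal.rpow_mul, ← ENNReal.rpow_mul,
    inv_mul_cancel₀ hs1.ne', ENNReal.rpow_one,
    show (1 - (1 + s)⁻¹) * (1 + s) = s by field_simp; ring]

/-- The one-dimensional Borell–Brascamp–Lieb inequality for bounded functions. -/
lemma ennrealPowMean_lintegral_le_of_bounded {a b s : ℝ} (ha : 0 < a) (hb : 0 < b) (hs : 0 < s)
    {f g h : ℝ → ℝ≥0∞} (hf : Measurable f) (hg : Measurable g) (hh : Measurable h)
    {c : ℝ≥0∞} (hc : c ≠ ∞) (hfc : ∀ x, f x ≤ c) (hgc : ∀ x, g x ≤ c)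
    (hf0 : ∫⁻ x, f x ≠ 0) (hg0 : ∫⁻ x, g x ≠ 0)
    (hyp : ∀ x y, f x ≠ 0 → g y ≠ 0 → ennrealPowMean a b s (f x) (g y) ≤ h (a * x + b * y)) :
    ennrealPowMean a b (1 + s) (∫⁻ x, f x) (∫⁻ x, g x) ≤ ∫⁻ x, h x := by
  have sup_ne_zero : ∀ {f : ℝ → ℝ≥0∞}, ∫⁻ x, f x ≠ 0 → ⨆ x, f x ≠ 0 := by
    intro f h0 h
    rw [ENNReal.iSup_eq_zero] at h
    exact h0 (by simp [h])
  have exists_lt : ∀ {f : ℝ → ℝ≥0∞}, ⨆ x, f x ≠ 0 → ⨆ x, f x ≠ ∞ → ∀ t < 1,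
      ∃ x, t < f x / ⨆ x, f x := by
    intro f h0 hT t ht
    simp only [ENNReal.lt_div_iff_mul_lt (Or.inl h0) (Or.inl hT)]
    refine lt_iSup_iff.1 ?_
    simpa using ENNReal.mul_lt_mul_left h0 hT ht
  have hM0 := sup_ne_zero hf0
  have hN0 := sup_ne_zero hg0
  have hM : ⨆ x, f x ≠ ∞ := ne_top_of_le_ne_top hc (iSup_le hfc)
  have hN : ⨆ x, g x ≠ ∞ := ne_top_of_le_ne_top hc (iSup_le hgc)
  have hφs := exists_lt hM0 hM
  have hψs := exists_lt hN0 hN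
  have hfM := le_iSup f
  have hgN := le_iSup g
  set M := ⨆ x, f x
  set N := ⨆ x, g x
  set Q := ennrealPowMean a b s M N with hQ
  have hs' : 0 < 1 / s := by positivity
  have hQ0 : Q ≠ 0 := by
    simp [hQ, ennrealPowMean, hM0, hN0, ha, hM, hN, hs, hs.not_gt]
  have hQT : Q ≠ ∞ := by
    refine ENNReal.rpow_ne_top_of_nonneg hs.le (ENNReal.add_ne_top.2 ⟨?_, ?_⟩) <;>
    exact ENNReal.mul_ne_top ENNReal.ofReal_ne_top
      (ENNReal.rpow_ne_top_of_nonneg hs'.le ‹_›)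
  have main := lintegral_add_le_of_min_le ha hb (φ := fun x => f x / M) (ψ := fun x => g x / N)
    (χ := fun x => h x / Q) (hf.div_const _) (hg.div_const _) (hh.div_const _)
    (fun x => ENNReal.div_le_of_le_mul (by simpa using hfM x))
    (fun x => ENNReal.div_le_of_le_mul (by simpa using hgN x)) hφs hψs ?_
  · simp only [div_eq_mul_inv] at main
    rw [lintegral_mul_const _ hf, lintegral_mul_const _ hg, lintegral_mul_const _ hh] at main
    simp only [← div_eq_mul_inv] at main
    rw [ENNReal.le_div_iff_mul_le (Or.inl hQ0) (Or.inl hQT), mul_comm] at main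
    exact (ennrealPowMean_le_mul hs hM0 hM hN0 hN).trans main
  · intro x y
    by_cases hx : f x = 0
    · simp [hx]
    by_cases hy : g y = 0
    · simp [hy]
    rw [ENNReal.le_div_iff_mul_le (Or.inl hQ0) (Or.inl hQT)]
    refine le_trans ?_ (hyp x y hx hy)
    set m := min (f x / M) (g y / N)
    have h1 : m * M ≤ f x :=
      (ENNReal.le_div_iff_mul_le (Or.inl hM0) (Or.inl hM)).1 (min_le_left _ _)
    have h2 : m * N ≤ g y :=
      (ENNReal.le_div_iff_mul_le (Or.inl hN0) (Or.inl hN)).1 (min_le_right _ _)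
    refine le_trans (le_of_eq ?_) (ennrealPowMean_mono hs h1 h2)
    unfold Q ennrealPowMean
    rw [ENNReal.mul_rpow_of_nonneg _ _ hs'.le, ENNReal.mul_rpow_of_nonneg _ _ hs'.le,
      mul_left_comm, mul_left_comm (ENNReal.ofReal b), ← mul_add,
      ENNReal.mul_rpow_of_nonneg _ _ hs.le, ← ENNReal.rpow_mul, one_div_mul_cancel hs.ne',
      ENNReal.rpow_one]

/-- The one-dimensional Borell–Brascamp–Lieb inequality. -/
lemma ennrealPowMean_lintegral_le_real {a b s : ℝ} (ha : 0 < a) (hb : 0 < b) (hs : 0 < s)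
    {f g h : ℝ → ℝ≥0∞} (hf : Measurable f) (hg : Measurable g) (hh : Measurable h)
    (hf0 : ∫⁻ x, f x ≠ 0) (hg0 : ∫⁻ x, g x ≠ 0)
    (hyp : ∀ x y, f x ≠ 0 → g y ≠ 0 → ennrealPowMean a b s (f x) (g y) ≤ h (a * x + b * y)) :
    ennrealPowMean a b (1 + s) (∫⁻ x, f x) (∫⁻ x, g x) ≤ ∫⁻ x, h x := by
  let tr : (ℝ → ℝ≥0∞) → ℕ → ℝ → ℝ≥0∞ := fun f k x => min (f x) (k + 1)
  have tr_meas : ∀ {f : ℝ → ℝ≥0∞}, Measurable f → ∀ k, Measurable (tr f k) :=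
    fun hf k => hf.min measurable_const
  have tr_ne : ∀ {f : ℝ → ℝ≥0∞}, Measurable f → ∫⁻ x, f x ≠ 0 → ∀ k, ∫⁻ x, tr f k x ≠ 0 := by
    intro f hf h0 k h
    refine h0 ?_
    rw [lintegral_eq_zero_iff (tr_meas hf k)] at h
    rw [lintegral_eq_zero_iff hf]
    filter_upwards [h] with x hx
    have hk : (k : ℝ≥0∞) + 1 ≠ 0 := by simp
    exact (min_eq_bot.1 hx).resolve_right hk
  have tr_lim : ∀ {f : ℝ → ℝ≥0∞}, Measurable f →
      Filter.Tendsto (fun k => ∫⁻ x, tr f k x) Filter.atTop (nhds (∫⁻ x, f x)) := by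
    intro f hf
    refine lintegral_tendsto_of_tendsto_of_monotone (fun k => (tr_meas hf k).aemeasurable)
      (Filter.Eventually.of_forall fun x k l hkl => ?_) (Filter.Eventually.of_forall fun x => ?_)
    · exact min_le_min_left _ (by gcongr)
    · have h1 : Filter.Tendsto (fun k : ℕ => ((k : ℝ≥0∞) + 1)) Filter.atTop (nhds ∞) := by
        simpa using ENNReal.tendsto_nat_nhds_top.add_const (1 : ℝ≥0∞)
      simpa [tr] using (tendsto_const_nhds (x := f x)).min h1
  refine le_of_tendsto' (((continuous_ennrealPowMean a b (1 + s)).tendsto (_, _)).comp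
    ((tr_lim hf).prodMk_nhds (tr_lim hg))) fun k => ?_
  refine ennrealPowMean_lintegral_le_of_bounded ha hb hs (tr_meas hf k) (tr_meas hg k) hh
    (c := k + 1) (by finiteness) (fun x => min_le_right _ _) (fun x => min_le_right _ _)
    (tr_ne hf hf0 k) (tr_ne hg hg0 k) fun x y hx hy => ?_
  refine (ennrealPowMean_mono hs (min_le_left _ _) (min_le_left _ _)).trans (hyp x y ?_ ?_)
  · exact fun h0 => hx (by simp [tr, h0])
  · exact fun h0 => hy (by simp [tr, h0])

lemma lintegral_fin_succ_pi {n : ℕ} {f : (Fin (n + 1) → ℝ) → ℝ≥0∞} (hf : Measurable f) :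
    ∫⁻ x, f x = ∫⁻ t : ℝ, ∫⁻ y : Fin n → ℝ, f (Fin.cons t y) := by
  let e := MeasurableEquiv.piFinSuccAbove (fun _ : Fin (n + 1) => ℝ) 0
  have he : MeasurePreserving e.symm volume volume :=
    (volume_preserving_piFinSuccAbove (fun _ : Fin (n + 1) => ℝ) 0).symm
  rw [← he.lintegral_comp hf, Measure.volume_eq_prod,
    lintegral_prod (fun z => f (e.symm z)) (hf.comp e.symm.measurable).aemeasurable]
  refine lintegral_congr fun t => lintegral_congr fun y => congrArg f ?_
  exact Fin.insertNth_zero' t y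

/-- The Borell–Brascamp–Lieb inequality for measurable functions with values in `[0, ∞]`. -/
theorem ennrealPowMean_lintegral_le_pi {a b s : ℝ} (ha : 0 < a) (hb : 0 < b) (hs : 0 < s)
    (n : ℕ) {f g h : (Fin n → ℝ) → ℝ≥0∞} (hf : Measurable f) (hg : Measurable g)
    (hh : Measurable h) (hf0 : ∫⁻ x, f x ≠ 0) (hg0 : ∫⁻ x, g x ≠ 0)
    (hyp : ∀ x y, f x ≠ 0 → g y ≠ 0 → ennrealPowMean a b s (f x) (g y) ≤ h (a • x + b • y)) :
    ennrealPowMean a b (n + s) (∫⁻ x, f x) (∫⁻ x, g x) ≤ ∫⁻ x, h x := by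
  induction n with
  | zero =>
    have hint : ∀ f : (Fin 0 → ℝ) → ℝ≥0∞, ∫⁻ x, f x = f 0 := by
      intro f
      rw [volume_pi, Measure.pi_of_empty (x := 0), lintegral_dirac]
    rw [hint] at hf0 hg0
    rw [hint, hint, hint]
    simpa using hyp 0 0 hf0 hg0
  | succ n ih =>
    have hcons : Measurable fun p : ℝ × (Fin n → ℝ) => (Fin.cons p.1 p.2 : Fin (n + 1) → ℝ) := by
      refine measurable_pi_iff.2 fun i => Fin.cases ?_ (fun j => ?_) i
      · simpa using measurable_fst
      · simp only [Fin.cons_succ]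
        fun_prop
    have hslice : ∀ t : ℝ, Measurable fun y : Fin n → ℝ => (Fin.cons t y : Fin (n + 1) → ℝ) :=
      fun t => hcons.comp measurable_prodMk_left
    have hmarg : ∀ {f : (Fin (n + 1) → ℝ) → ℝ≥0∞}, Measurable f →
        Measurable fun t : ℝ => ∫⁻ y : Fin n → ℝ, f (Fin.cons t y) :=
      fun hf => (hf.comp hcons).lintegral_prod_right'
    rw [lintegral_fin_succ_pi hf] at hf0 ⊢
    rw [lintegral_fin_succ_pi hg] at hg0 ⊢
    rw [lintegral_fin_succ_pi hh,
      show ((n + 1 : ℕ) : ℝ) + s = 1 + (n + s) by push_cast; ring]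
    refine ennrealPowMean_lintegral_le_real ha hb (by positivity) (hmarg hf) (hmarg hg)
      (hmarg hh) hf0 hg0 fun t u ht hu => ?_
    refine ih (hf.comp (hslice t)) (hg.comp (hslice u)) (hh.comp (hslice _)) ht hu
      fun x y hx hy => ?_
    refine (hyp _ _ hx hy).trans_eq ?_
    refine congrArg h ?_
    ext i
    refine Fin.cases ?_ (fun j => ?_) i <;> simp

lemma exists_measurable_ge_ae_eq {α : Type*} [MeasurableSpace α] {μ : Measure α}
    {f : α → ℝ≥0∞} (hf : AEMeasurable f μ) : ∃ g, Measurable g ∧ f ≤ g ∧ f =ᵐ[μ] g := by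
  classical
  let S := toMeasurable μ {x | f x ≠ hf.mk f x}
  refine ⟨S.piecewise (fun _ => ∞) (hf.mk f),
    measurable_const.piecewise (measurableSet_toMeasurable _ _) hf.measurable_mk, fun x => ?_, ?_⟩
  · by_cases hx : x ∈ S
    · simp [hx]
    · have : f x = hf.mk f x := by
        by_contra h
        exact hx (subset_toMeasurable _ _ h)
      simp [hx, this]
  · have hS : μ S = 0 := by
      rw [measure_toMeasurable]
      exact hf.ae_eq_mk
    filter_upwards [hf.ae_eq_mk, measure_eq_zero_iff_ae_notMem.1 hS] with x hx hxS
    simp [hxS, hx]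

/-- **Borell–Brascamp–Lieb inequality for `p = 1/s` with arbitrary real `s > 0`.**
Let `s > 0` be real, `λ ∈ (0,1)`, `n > 0` an integer, and let `f, g, h : ℝⁿ → [0,∞)` be
integrable with `∫ f > 0` and `∫ g > 0`. If
`h((1−λ)x₀ + λx₁) ≥ ((1−λ)f(x₀)^{1/s} + λ g(x₁)^{1/s})^s` for every `x₀ ∈ supp(f)` and
`x₁ ∈ supp(g)`, then `(∫ h)^{1/(n+s)} ≥ (1−λ)(∫ f)^{1/(n+s)} + λ(∫ g)^{1/(n+s)}`. -/
theorem bbl_real_index (s : ℝ) (hs : 0 < s) (lam : ℝ) (hlam : lam ∈ Set.Ioo (0 : ℝ) 1)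
    (n : ℕ) (hn : 0 < n)
    (f g h : (Fin n → ℝ) → ℝ)
    (hf0 : ∀ x, 0 ≤ f x) (hg0 : ∀ x, 0 ≤ g x) (hh0 : ∀ x, 0 ≤ h x)
    (hfi : Integrable f) (hgi : Integrable g) (hhi : Integrable h)
    (hF : 0 < ∫ x, f x) (hG : 0 < ∫ x, g x)
    (hyp : ∀ x₀ ∈ closure {x | 0 < f x}, ∀ x₁ ∈ closure {x | 0 < g x},
      ((1 - lam) * f x₀ ^ (1 / s) + lam * g x₁ ^ (1 / s)) ^ s
        ≤ h ((1 - lam) • x₀ + lam • x₁)) :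
    (1 - lam) * (∫ x, f x) ^ (1 / (n + s)) + lam * (∫ x, g x) ^ (1 / (n + s))
      ≤ (∫ x, h x) ^ (1 / (n + s)) := by
  obtain ⟨hl0, hl1⟩ := hlam
  have ha : 0 < 1 - lam := by linarith
  have mean_ofReal : ∀ {r x y : ℝ}, 0 < r → 0 ≤ x → 0 ≤ y →
      ennrealPowMean (1 - lam) lam r (ENNReal.ofReal x) (ENNReal.ofReal y) =
        ENNReal.ofReal (((1 - lam) * x ^ (1 / r) + lam * y ^ (1 / r)) ^ r) := by
    intro r x y hr hx hy
    have hr' : 0 ≤ 1 / r := by positivity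
    unfold ennrealPowMean
    rw [ENNReal.ofReal_rpow_of_nonneg hx hr', ENNReal.ofReal_rpow_of_nonneg hy hr',
      ← ENNReal.ofReal_mul ha.le, ← ENNReal.ofReal_mul hl0.le,
      ← ENNReal.ofReal_add (by positivity) (by positivity),
      ENNReal.ofReal_rpow_of_nonneg (by positivity) hr.le]
  obtain ⟨f', hf'm, hf'le, hf'⟩ :=
    exists_measurable_le_lintegral_eq volume fun x => ENNReal.ofReal (f x)
  obtain ⟨g', hg'm, hg'le, hg'⟩ :=
    exists_measurable_le_lintegral_eq volume fun x => ENNReal.ofReal (g x)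
  obtain ⟨h', hh'm, hh'le, hh'⟩ :=
    exists_measurable_ge_ae_eq hhi.aestronglyMeasurable.aemeasurable.ennreal_ofReal
  rw [← ofReal_integral_eq_lintegral_ofReal hfi (Filter.Eventually.of_forall hf0)] at hf'
  rw [← ofReal_integral_eq_lintegral_ofReal hgi (Filter.Eventually.of_forall hg0)] at hg'
  have hh'' := lintegral_congr_ae hh'
  rw [← ofReal_integral_eq_lintegral_ofReal hhi (Filter.Eventually.of_forall hh0)] at hh''
  have hns : 0 < (n : ℝ) + s := by positivity
  have key := ennrealPowMean_lintegral_le_pi ha hl0 hs n hf'm hg'm hh'm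
    (by rw [← hf']; simpa using hF) (by rw [← hg']; simpa using hG) fun x y hx hy => ?_
  · rw [← hf', ← hg', ← hh'', mean_ofReal hns hF.le hG.le,
      ENNReal.ofReal_le_ofReal_iff (integral_nonneg hh0)] at key
    have := Real.rpow_le_rpow (by positivity) key (one_div_nonneg.2 hns.le)
    rwa [← Real.rpow_mul (by positivity), mul_one_div_cancel hns.ne', Real.rpow_one] at this
  · have hfx : 0 < f x := ENNReal.ofReal_pos.1 ((pos_iff_ne_zero.2 hx).trans_le (hf'le x))
    have hgy : 0 < g y := ENNReal.ofReal_pos.1 ((pos_iff_ne_zero.2 hy).trans_le (hg'le y))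
    refine (ennrealPowMean_mono hs (hf'le x) (hg'le y)).trans (le_trans ?_ (hh'le _))
    rw [mean_ofReal hs hfx.le hgy.le]
    exact ENNReal.ofReal_le_ofReal (hyp x (subset_closure hfx) y (subset_closure hgy))
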